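/- arXiv:1107.1720 — 2 statements merged into one kernel-verified Lean document; each statement's English description precedes it below -/
import Mathlib

section
/- Let δ > 0. Let X₁ be a curve in ℝ^d and let X₂ = X₁[s,t] (for some 0 ≤ s ≤ t ≤ 1) be a subcurve of X₁, and let h₁, h₂ be segments in ℝ^d. If d_F(X₁, h₁) ≤ δ, the start point of X₂ is at distance at most δ from the start point of h₂, and the end point of X₂ is at distance at most δ from the end point of h₂, then d_F(X₂, h₂) ≤ 3δ. -/
open Set

noncomputable section

namespace Jaywalk

variable {d : ℕ}

/-- An orientation-preserving reparameterization of `[0,1]`: a continuous, strictly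
increasing bijection of `[0,1]` onto itself with `f 0 = 0` and `f 1 = 1`. -/
structure IsReparam (f : ℝ → ℝ) : Prop where
  contOn : ContinuousOn f (Icc 0 1)
  strictMonoOn : StrictMonoOn f (Icc 0 1)
  mapsTo : MapsTo f (Icc 0 1) (Icc 0 1)
  surjOn : SurjOn f (Icc 0 1) (Icc 0 1)
  map_zero : f 0 = 0
  map_one : f 1 = 1

/-- The width of a reparameterization `f` with respect to curves `X Y : [0,1] → ℝ^d`. -/
def frechetWidth (X Y : ℝ → EuclideanSpace ℝ (Fin d)) (f : ℝ → ℝ) : ℝ :=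
  ⨆ t : Icc (0:ℝ) 1, ‖X (f ↑t) - Y ↑t‖

/-- The Fréchet distance between two curves `X Y : [0,1] → ℝ^d`. -/
def frechetDist (X Y : ℝ → EuclideanSpace ℝ (Fin d)) : ℝ :=
  sInf {w | ∃ f, IsReparam f ∧ w = frechetWidth X Y f}

/-- The segment from `p` to `q`, as a curve `t ↦ (1-t)·p + t·q`. -/
def seg (p q : EuclideanSpace ℝ (Fin d)) : ℝ → EuclideanSpace ℝ (Fin d) :=
  fun t => (1 - t) • p + t • q

/-- The subcurve `Z[s,t]`, affinely reparameterized over `[0,1]`. -/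
def subcurve (Z : ℝ → EuclideanSpace ℝ (Fin d)) (s t : ℝ) : ℝ → EuclideanSpace ℝ (Fin d) :=
  fun τ => Z (s + τ * (t - s))

/-- Vertices extended to all of `ℕ` (clamped at `n`). -/
def vtx {n : ℕ} (v : Fin (n+1) → EuclideanSpace ℝ (Fin d)) (i : ℕ) :
    EuclideanSpace ℝ (Fin d) :=
  v ⟨min i n, Nat.lt_succ_of_le (min_le_right i n)⟩

/-- The uniformly parameterized polygonal curve through the vertices `v 0, …, v n`. -/
def polyCurve {n : ℕ} (v : Fin (n+1) → EuclideanSpace ℝ (Fin d)) :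
    ℝ → EuclideanSpace ℝ (Fin d) :=
  fun t =>
    (1 - (t * n - ⌊t * n⌋₊)) • vtx v ⌊t * n⌋₊ + (t * n - ⌊t * n⌋₊) • vtx v (⌊t * n⌋₊ + 1)

/-- Concatenation of two curves (sharing an endpoint). -/
def concat (A B : ℝ → EuclideanSpace ℝ (Fin d)) : ℝ → EuclideanSpace ℝ (Fin d) :=
  fun t => if t ≤ 1/2 then A (2 * t) else B (2 * t - 1)

/-- Concatenation of a finite list of curves. -/
def concatList : List (ℝ → EuclideanSpace ℝ (Fin d)) → ℝ → EuclideanSpace ℝ (Fin d)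
  | [] => fun _ => 0
  | [A] => A
  | A :: B :: rest => concat A (concatList (B :: rest))

/-- Given curves `X Y`, the price of the tunnel from `a` to `b` (points of `[0,1]²`):
the Fréchet distance between the subcurve `X[a.1, b.1]` and the segment from
`Y a.2` to `Y b.2`. -/
def tunnelPrice (X Y : ℝ → EuclideanSpace ℝ (Fin d)) (a b : ℝ × ℝ) : ℝ :=
  frechetDist (subcurve X a.1 b.1) (seg (Y a.2) (Y b.2))

open Classical in
/-- Indices of marked vertices in the greedy `μ`-simplification of the polygonal curve with
vertices `v 0, …, v n`:  start at vertex `0`; repeatedly jump to the first later vertex at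
distance at least `μ` from the current one; finally also mark the last vertex `n`
(the sequence stabilizes at `n`). -/
def simplIdx (v : ℕ → EuclideanSpace ℝ (Fin d)) (μ : ℝ) (n : ℕ) : ℕ → ℕ
  | 0 => 0
  | k+1 =>
    if h : ∃ j, simplIdx v μ n k < j ∧ j ≤ n ∧ μ ≤ ‖v j - v (simplIdx v μ n k)‖
    then Nat.find h
    else n

/-- The vertices of the `μ`-simplification (with the final vertex repeated). -/
def simplVerts {n : ℕ} (v : Fin (n+1) → EuclideanSpace ℝ (Fin d)) (μ : ℝ) :
    Fin (n+1) → EuclideanSpace ℝ (Fin d) :=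
  fun k => vtx v (simplIdx (vtx v) μ n k.val)

/-- The `μ`-simplification `simpl(X, μ)` of the polygonal curve with vertices
`v 0, …, v n`: the polygonal curve through the marked vertices, in order. -/
def simpl {n : ℕ} (v : Fin (n+1) → EuclideanSpace ℝ (Fin d)) (μ : ℝ) :
    ℝ → EuclideanSpace ℝ (Fin d) :=
  polyCurve (simplVerts v μ)

/-- `y` is the parameter of a vertex of a (uniformly parameterized) polygonal curve
with `n` edges. -/
def vertexParam (n : ℕ) (y : ℝ) : Prop := ∃ i : Fin (n+1), y = ((i : ℕ) : ℝ) / n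

/-- The shortcut curve of `Y` determined by the list of shortcut parameter pairs,
starting from parameter `a`. -/
def shortcutFrom (Y : ℝ → EuclideanSpace ℝ (Fin d)) :
    List (ℝ × ℝ) → ℝ → ℝ → EuclideanSpace ℝ (Fin d)
  | [], a => subcurve Y a 1
  | (y₁, y₂) :: rest, a =>
      concat (subcurve Y a y₁) (concat (seg (Y y₁) (Y y₂)) (shortcutFrom Y rest y₂))

/-- The shortcut parameter pairs form a nondecreasing sequence inside `[0,1]` and all
parameters are vertices of the polygonal curve with `n` edges. -/
def ValidShortcuts (n : ℕ) (L : List (ℝ × ℝ)) : Prop :=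
  List.Chain' (· ≤ ·) ((0:ℝ) :: (L.flatMap fun p => [p.1, p.2]) ++ [1]) ∧
  ∀ p ∈ L, vertexParam n p.1 ∧ vertexParam n p.2

/-- The directed vertex-restricted `k`-shortcut Fréchet distance between a curve `X` and the
polygonal curve with vertices `w 0, …, w n`: the infimum of the Fréchet distance between `X`
and any vertex-restricted shortcut curve of `polyCurve w` with at most `k` shortcuts. -/
def shortcutFrechetDist {n : ℕ} (X : ℝ → EuclideanSpace ℝ (Fin d))
    (w : Fin (n+1) → EuclideanSpace ℝ (Fin d)) (k : ℕ) : ℝ :=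
  sInf {r | ∃ L : List (ℝ × ℝ), L.length ≤ k ∧ ValidShortcuts n L ∧
    r = frechetDist X (shortcutFrom (polyCurve w) L 0)}

/-- The directed vertex-restricted shortcut Fréchet distance (unbounded number of
shortcuts). -/
def shortcutFrechetDistUnbounded {n : ℕ} (X : ℝ → EuclideanSpace ℝ (Fin d))
    (w : Fin (n+1) → EuclideanSpace ℝ (Fin d)) : ℝ :=
  sInf {r | ∃ L : List (ℝ × ℝ), ValidShortcuts n L ∧
    r = frechetDist X (shortcutFrom (polyCurve w) L 0)}

/-- A pointwise bound under some reparameterization bounds the Fréchet distance. -/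
lemma frechetDist_le_of_reparam {X Y : ℝ → EuclideanSpace ℝ (Fin d)} {f : ℝ → ℝ} {r : ℝ}
    (hf : IsReparam f) (h : ∀ τ ∈ Icc (0:ℝ) 1, ‖X (f τ) - Y τ‖ ≤ r) : frechetDist X Y ≤ r := by
  have hbdd : BddBelow {w | ∃ f, IsReparam f ∧ w = frechetWidth X Y f} := by
    refine ⟨0, ?_⟩
    rintro w ⟨g, -, rfl⟩
    exact Real.iSup_nonneg fun _ => norm_nonneg _
  have : Nonempty (Icc (0:ℝ) 1) := ⟨⟨0, by simp⟩⟩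
  exact (csInf_le hbdd ⟨f, hf, rfl⟩).trans (ciSup_le fun τ => h τ τ.2)

lemma isReparam_id : IsReparam id where
  contOn := continuousOn_id
  strictMonoOn := strictMonoOn_id
  mapsTo := mapsTo_id _
  surjOn := surjOn_id _
  map_zero := rfl
  map_one := rfl

/-- For continuous curves, any bound exceeding the Fréchet distance is attained pointwise by some
reparameterization. -/
lemma exists_reparam_of_frechetDist_lt {X Y : ℝ → EuclideanSpace ℝ (Fin d)} {r : ℝ}
    (hX : ContinuousOn X (Icc 0 1)) (hY : ContinuousOn Y (Icc 0 1)) (h : frechetDist X Y < r) :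
    ∃ f, IsReparam f ∧ ∀ τ ∈ Icc (0:ℝ) 1, ‖X (f τ) - Y τ‖ ≤ r := by
  obtain ⟨w, ⟨f, hf, rfl⟩, hw⟩ := exists_lt_of_csInf_lt
    (s := {w | ∃ f, IsReparam f ∧ w = frechetWidth X Y f}) ⟨_, id, isReparam_id, rfl⟩ h
  refine ⟨f, hf, fun τ hτ => le_trans ?_ hw.le⟩
  have hbdd : BddAbove (range fun t : Icc (0:ℝ) 1 => ‖X (f ↑t) - Y ↑t‖) := by
    have := (isCompact_Icc.image_of_continuousOn
      ((hX.comp hf.contOn hf.mapsTo).sub hY).norm).bddAbove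
    rwa [image_eq_range] at this
  exact le_ciSup hbdd ⟨τ, hτ⟩

lemma continuous_seg (p q : EuclideanSpace ℝ (Fin d)) : Continuous (seg p q) := by
  unfold seg
  fun_prop

lemma seg_seg (p q : EuclideanSpace ℝ (Fin d)) (u v τ : ℝ) :
    seg (seg p q u) (seg p q v) τ = seg p q (u + τ * (v - u)) := by
  simp only [seg]
  module

/-- Segments whose endpoints are within `r` stay within `r` pointwise. -/
lemma norm_seg_sub_seg_le {p q p' q' : EuclideanSpace ℝ (Fin d)} {r τ : ℝ}
    (hp : ‖p - p'‖ ≤ r) (hq : ‖q - q'‖ ≤ r) (hτ : τ ∈ Icc (0:ℝ) 1) :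
    ‖seg p q τ - seg p' q' τ‖ ≤ r := by
  have h : seg p q τ - seg p' q' τ = (1 - τ) • (p - p') + τ • (q - q') := by
    simp only [seg]
    module
  have h0 : 0 ≤ 1 - τ := sub_nonneg.2 hτ.2
  calc ‖seg p q τ - seg p' q' τ‖ ≤ ‖(1 - τ) • (p - p')‖ + ‖τ • (q - q')‖ := h ▸ norm_add_le _ _
    _ = (1 - τ) * ‖p - p'‖ + τ * ‖q - q'‖ := by
      rw [norm_smul_of_nonneg h0, norm_smul_of_nonneg hτ.1]
    _ ≤ (1 - τ) * r + τ * r := by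
      have := hτ.1
      gcongr
    _ = r := by ring

lemma add_mul_sub_mem_Icc {u v τ : ℝ} (huv : u ≤ v) (hτ : τ ∈ Icc (0:ℝ) 1) :
    u + τ * (v - u) ∈ Icc u v := by
  constructor <;> nlinarith [hτ.1, hτ.2]

/-- Restricting a reparameterization to `[u, v]` and rescaling both its domain and its range to
`[0, 1]` gives a reparameterization. -/
lemma IsReparam.restrict {f : ℝ → ℝ} (hf : IsReparam f) {u v : ℝ} (hu : 0 ≤ u) (huv : u < v)
    (hv : v ≤ 1) : IsReparam fun τ => (f (u + τ * (v - u)) - f u) / (f v - f u) := by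
  have hsub : Icc u v ⊆ Icc 0 1 := Icc_subset_Icc hu hv
  have hmem : MapsTo (fun τ => u + τ * (v - u)) (Icc 0 1) (Icc 0 1) :=
    fun τ hτ => hsub (add_mul_sub_mem_Icc huv.le hτ)
  have hpos : 0 < f v - f u :=
    sub_pos.2 (hf.strictMonoOn (hsub (left_mem_Icc.2 huv.le)) (hsub (right_mem_Icc.2 huv.le)) huv)
  have h0 : (fun τ => (f (u + τ * (v - u)) - f u) / (f v - f u)) 0 = 0 := by simp
  have h1 : (fun τ => (f (u + τ * (v - u)) - f u) / (f v - f u)) 1 = 1 := by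
    simp [hpos.ne']
  have hcont : ContinuousOn (fun τ => (f (u + τ * (v - u)) - f u) / (f v - f u)) (Icc 0 1) :=
    ((hf.contOn.comp (by fun_prop) hmem).sub continuousOn_const).div_const _
  have hmono : StrictMonoOn (fun τ => (f (u + τ * (v - u)) - f u) / (f v - f u)) (Icc 0 1) := by
    intro x hx y hy hxy
    have := hf.strictMonoOn (hmem hx) (hmem hy)
      (add_lt_add_right (mul_lt_mul_of_pos_right hxy (sub_pos.2 huv)) u)
    exact div_lt_div_of_pos_right (sub_lt_sub_right this _) hpos
  refine ⟨hcont, hmono, fun x hx => ⟨?_, ?_⟩, ?_, h0, h1⟩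
  · exact h0.symm.trans_le (hmono.monotoneOn (left_mem_Icc.2 zero_le_one) hx hx.1)
  · exact (hmono.monotoneOn hx (right_mem_Icc.2 zero_le_one) hx.2).trans_eq h1
  · exact (Icc_subset_Icc h0.le h1.ge).trans (intermediate_value_Icc zero_le_one hcont)

/-- If `d_F(X₁, h₁) ≤ δ`, and the endpoints of the subcurve
`X₂ = X₁[s,t]` are within distance `δ` of the corresponding endpoints of a segment `h₂`,
then `d_F(X₂, h₂) ≤ 3δ`. -/
theorem frechetDist_subcurve_seg_le {d : ℕ} (δ : ℝ) (hδ : 0 < δ)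
    (X₁ : ℝ → EuclideanSpace ℝ (Fin d)) (hX : ContinuousOn X₁ (Icc 0 1))
    (s t : ℝ) (hs : 0 ≤ s) (hst : s ≤ t) (ht : t ≤ 1)
    (a b c e : EuclideanSpace ℝ (Fin d))
    (h₁ : frechetDist X₁ (seg a b) ≤ δ)
    (hstart : ‖X₁ s - c‖ ≤ δ) (hend : ‖X₁ t - e‖ ≤ δ) :
    frechetDist (subcurve X₁ s t) (seg c e) ≤ 3 * δ := by
  rcases hst.eq_or_lt with rfl | hlt
  · refine frechetDist_le_of_reparam isReparam_id fun τ hτ => ?_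
    have h := norm_seg_sub_seg_le hstart hend hτ
    have hconst : seg (X₁ s) (X₁ s) τ = subcurve X₁ s s (id τ) := by
      simp only [seg, subcurve, sub_self, mul_zero, add_zero]
      module
    rw [hconst] at h
    linarith
  refine le_of_forall_pos_le_add fun ε hε => ?_
  obtain ⟨f, hf, hfw⟩ := exists_reparam_of_frechetDist_lt hX (continuous_seg a b).continuousOn
    (h₁.trans_lt (lt_add_of_pos_right δ (half_pos hε)))
  obtain ⟨u, hu, rfl⟩ := hf.surjOn ⟨hs, hst.trans ht⟩
  obtain ⟨v, hv, rfl⟩ := hf.surjOn ⟨hs.trans hst, ht⟩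
  have huv : u < v := (hf.strictMonoOn.lt_iff_lt hu hv).1 hlt
  refine frechetDist_le_of_reparam (hf.restrict hu.1 huv hv.2) fun τ hτ => ?_
  have hmem : u + τ * (v - u) ∈ Icc (0:ℝ) 1 :=
    Icc_subset_Icc hu.1 hv.2 (add_mul_sub_mem_Icc huv.le hτ)
  have hsubcurve : subcurve X₁ (f u) (f v) ((f (u + τ * (v - u)) - f u) / (f v - f u)) =
      X₁ (f (u + τ * (v - u))) := by
    simp only [subcurve]
    rw [div_mul_cancel₀ _ (sub_pos.2 hlt).ne', add_sub_cancel]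
  have hp : ‖seg a b u - c‖ ≤ 2 * δ + ε / 2 := by
    have := norm_sub_le_norm_sub_add_norm_sub (seg a b u) (X₁ (f u)) c
    rw [norm_sub_rev _ (X₁ (f u))] at this
    linarith [hfw u hu]
  have hq : ‖seg a b v - e‖ ≤ 2 * δ + ε / 2 := by
    have := norm_sub_le_norm_sub_add_norm_sub (seg a b v) (X₁ (f v)) e
    rw [norm_sub_rev _ (X₁ (f v))] at this
    linarith [hfw v hv]
  have hseg := norm_seg_sub_seg_le hp hq hτ
  rw [seg_seg] at hseg
  rw [hsubcurve]
  linarith [hfw _ hmem, norm_sub_le_norm_sub_add_norm_sub (X₁ (f (u + τ * (v - u))))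
    (seg a b (u + τ * (v - u))) (seg c e τ)]

end Jaywalk
end
end

section
/- For any polygonal curve X in ℝ^d and any μ > 0, the Fréchet distance between X and its μ-simplification satisfies d_F(simpl(X,μ), X) ≤ μ. -/
open Set

noncomputable section

namespace Jaywalk

variable {d : ℕ}

/-- The continuous piecewise linear function with value `c i` at each integer `i ∈ {0, …, N}`,
extended by constants outside `[0, N]`. -/
def piecewiseLinear {E : Type*} [AddCommGroup E] [Module ℝ E] (N : ℕ) (c : ℕ → E) (x : ℝ) : E :=
  c 0 + ∑ i ∈ Finset.range N, (max 0 (min 1 (x - i))) • (c (i + 1) - c i)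

section PiecewiseLinear

variable {E : Type*} [NormedAddCommGroup E] [NormedSpace ℝ E]

theorem piecewiseLinear_add (N : ℕ) (c : ℕ → E) {j : ℕ} (hj : j < N) {s : ℝ}
    (hs : s ∈ Icc (0 : ℝ) 1) :
    piecewiseLinear N c (j + s) = (1 - s) • c j + s • c (j + 1) := by
  obtain ⟨hs0, hs1⟩ := hs
  induction N with
  | zero => omega
  | succ N ih =>
    rcases Nat.lt_succ_iff_lt_or_eq.mp hj with h | rfl
    · rw [← ih h, piecewiseLinear, piecewiseLinear, Finset.sum_range_succ]
      have h1 : (j : ℝ) + 1 ≤ N := by exact_mod_cast h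
      rw [max_eq_left ((min_le_right _ _).trans (by linarith)), zero_smul, add_zero]
    · have h : ∀ i ∈ Finset.range j,
          (max 0 (min 1 ((j : ℝ) + s - i))) • (c (i + 1) - c i) = c (i + 1) - c i := by
        intro i hi
        have h1 : (i : ℝ) + 1 ≤ j := by exact_mod_cast Finset.mem_range.mp hi
        rw [min_eq_left (by linarith), max_eq_right zero_le_one, one_smul]
      rw [piecewiseLinear, Finset.sum_range_succ, Finset.sum_congr rfl h, Finset.sum_range_sub,
        add_sub_cancel_left, min_eq_right hs1, max_eq_right hs0]
      module

theorem piecewiseLinear_natCast (N : ℕ) (c : ℕ → E) {j : ℕ} (hj : j < N) :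
    piecewiseLinear N c j = c j := by
  simpa using piecewiseLinear_add N c hj (s := 0) (by simp)

theorem continuous_piecewiseLinear (N : ℕ) (c : ℕ → E) : Continuous (piecewiseLinear N c) := by
  unfold piecewiseLinear
  fun_prop

theorem monotone_piecewiseLinear (N : ℕ) {c : ℕ → ℝ} (hc : Monotone c) :
    Monotone (piecewiseLinear N c) := by
  intro x y hxy
  unfold piecewiseLinear
  gcongr with i
  exact sub_nonneg.mpr (hc i.le_succ)

theorem exists_eq_natCast_add {n : ℕ} {x : ℝ} (hx : x ∈ Icc (0 : ℝ) n) :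
    ∃ j < n + 1, ∃ s ∈ Icc (0 : ℝ) 1, x = j + s := by
  refine ⟨⌊x⌋₊, Nat.lt_succ_of_le (Nat.floor_le_of_le hx.2), x - ⌊x⌋₊, ⟨?_, ?_⟩, by ring⟩
  · linarith [Nat.floor_le hx.1]
  · linarith [Nat.lt_floor_add_one x]

theorem norm_piecewiseLinear_sub_le {n : ℕ} {c c' : ℕ → E} {r : ℝ} (h : ∀ j, ‖c j - c' j‖ ≤ r)
    {x : ℝ} (hx : x ∈ Icc (0 : ℝ) n) :
    ‖piecewiseLinear (n + 1) c x - piecewiseLinear (n + 1) c' x‖ ≤ r := by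
  obtain ⟨j, hj, s, hs, rfl⟩ := exists_eq_natCast_add hx
  rw [piecewiseLinear_add _ _ hj hs, piecewiseLinear_add _ _ hj hs]
  have hs' : 0 ≤ 1 - s := by linarith [hs.2]
  calc ‖(1 - s) • c j + s • c (j + 1) - ((1 - s) • c' j + s • c' (j + 1))‖
      = ‖(1 - s) • (c j - c' j) + s • (c (j + 1) - c' (j + 1))‖ := by congr 1; module
    _ ≤ (1 - s) * ‖c j - c' j‖ + s * ‖c (j + 1) - c' (j + 1)‖ := by
        refine (norm_add_le _ _).trans_eq ?_
        rw [norm_smul, norm_smul, Real.norm_of_nonneg hs', Real.norm_of_nonneg hs.1]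
    _ ≤ (1 - s) * r + s * r := by
        have := hs.1
        gcongr <;> apply h
    _ = r := by ring

theorem piecewiseLinear_piecewiseLinear {n : ℕ} (w : ℕ → E) {c : ℕ → ℕ}
    (hc : ∀ j, c (j + 1) = c j ∨ c (j + 1) = c j + 1) (hcn : ∀ j, c j ≤ n)
    {x : ℝ} (hx : x ∈ Icc (0 : ℝ) n) :
    piecewiseLinear (n + 1) w (piecewiseLinear (n + 1) (fun j => (c j : ℝ)) x) =
      piecewiseLinear (n + 1) (w ∘ c) x := by
  obtain ⟨j, hj, s, hs, rfl⟩ := exists_eq_natCast_add hx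
  rw [piecewiseLinear_add _ _ hj hs, piecewiseLinear_add _ _ hj hs]
  have hcj := Nat.lt_succ_of_le (hcn j)
  rcases hc j with h | h
  · rw [Function.comp_apply, Function.comp_apply, h, ← add_smul, ← add_smul, sub_add_cancel,
      one_smul, one_smul, piecewiseLinear_natCast _ _ hcj]
  · rw [Function.comp_apply, Function.comp_apply, h, ← piecewiseLinear_add _ w hcj hs]
    congr 1
    push_cast
    ring

end PiecewiseLinear

theorem polyCurve_eq_piecewiseLinear {n : ℕ} (v : Fin (n + 1) → EuclideanSpace ℝ (Fin d)) {t : ℝ}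
    (ht : t ∈ Icc (0 : ℝ) 1) :
    polyCurve v t = piecewiseLinear (n + 1) (vtx v) (t * n) := by
  have h0 : 0 ≤ t * n := mul_nonneg ht.1 n.cast_nonneg
  have h1 : t * n ≤ n := mul_le_of_le_one_left n.cast_nonneg ht.2
  have h := piecewiseLinear_add (n + 1) (vtx v) (Nat.lt_succ_of_le (Nat.floor_le_of_le h1))
    (s := t * n - ⌊t * n⌋₊)
    ⟨by linarith [Nat.floor_le h0], by linarith [Nat.lt_floor_add_one (t * n)]⟩
  rw [add_sub_cancel] at h
  exact h.symm

theorem frechetDist_le_of_forall {A B : ℝ → EuclideanSpace ℝ (Fin d)} {f : ℝ → ℝ} {r : ℝ}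
    (hf : IsReparam f) (h : ∀ t ∈ Icc (0 : ℝ) 1, ‖A (f t) - B t‖ ≤ r) :
    frechetDist A B ≤ r := by
  have hr : 0 ≤ r := (norm_nonneg _).trans (h 0 (by simp))
  have hbdd : BddBelow {w | ∃ f, IsReparam f ∧ w = frechetWidth A B f} := by
    refine ⟨0, ?_⟩
    rintro _ ⟨g, -, rfl⟩
    exact Real.iSup_nonneg fun _ => norm_nonneg _
  have hw : frechetWidth A B f ≤ r := Real.iSup_le (fun t => h t t.2) hr
  exact (csInf_le hbdd ⟨f, hf, rfl⟩).trans hw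

theorem isReparam_of_continuousOn_of_strictMonoOn {f : ℝ → ℝ} (hc : ContinuousOn f (Icc 0 1))
    (hm : StrictMonoOn f (Icc 0 1)) (h0 : f 0 = 0) (h1 : f 1 = 1) : IsReparam f where
  contOn := hc
  strictMonoOn := hm
  mapsTo t ht := by
    constructor
    · exact h0 ▸ hm.monotoneOn (by simp) ht ht.1
    · exact h1 ▸ hm.monotoneOn ht (by simp) ht.2
  surjOn := by
    have := intermediate_value_Icc zero_le_one hc
    rwa [h0, h1] at this
  map_zero := h0
  map_one := h1

/-- A continuous monotone, not necessarily strictly increasing `φ` bounds the Fréchet distance like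
a reparameterization does; `φ` may even stop before `1` if `A` is constant from there on. -/
theorem frechetDist_le_of_monotoneOn {A B : ℝ → EuclideanSpace ℝ (Fin d)} {φ : ℝ → ℝ} {r : ℝ}
    (hA : ContinuousOn A (Icc 0 1)) (hφ : ContinuousOn φ (Icc 0 1)) (hmono : MonotoneOn φ (Icc 0 1))
    (hφ0 : φ 0 = 0) (hφ1 : φ 1 ≤ 1) (hconst : ∀ x ∈ Icc (φ 1) 1, A x = A (φ 1))
    (h : ∀ t ∈ Icc (0 : ℝ) 1, ‖A (φ t) - B t‖ ≤ r) :
    frechetDist A B ≤ r := by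
  refine le_of_forall_pos_le_add fun ε hε => ?_
  have hφm : ∀ t ∈ Icc (0 : ℝ) 1, φ t ∈ Icc 0 (φ 1) := fun t ht =>
    ⟨hφ0 ▸ hmono (by simp) ht ht.1, hmono ht (by simp) ht.2⟩
  obtain ⟨η, hη, hAη⟩ := Metric.uniformContinuousOn_iff.mp
    (isCompact_Icc.uniformContinuousOn_of_continuous hA) ε hε
  obtain ⟨δ', hδ', hφδ⟩ := Metric.continuousWithinAt_iff.mp (hφ 1 (by simp)) η hη
  obtain ⟨δ, hδ, hδm⟩ : ∃ δ : ℝ, 0 < δ ∧ δ < min (min 1 δ') η :=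
    exists_between (by positivity)
  obtain ⟨⟨hδ1, hδδ'⟩, hδη⟩ : (δ < 1 ∧ δ < δ') ∧ δ < η := by simpa using hδm
  set G : ℝ → ℝ := fun t => max ((1 - δ) * φ t + δ * t) (1 - (1 - t) / δ) with hG
  have hGr : IsReparam G := by
    refine isReparam_of_continuousOn_of_strictMonoOn (by fun_prop) ?_ ?_ ?_
    · intro x hx y hy hxy
      have h1 : (1 - δ) * φ x ≤ (1 - δ) * φ y :=
        mul_le_mul_of_nonneg_left (hmono hx hy hxy.le) (by linarith)
      have h2 : δ * x < δ * y := by gcongr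
      have h3 : (1 - y) / δ < (1 - x) / δ := by gcongr
      exact max_lt_max (by linarith) (by linarith)
    · have : 1 ≤ 1 / δ := by rw [le_div_iff₀ hδ]; linarith
      simp only [hG, hφ0]
      rw [mul_zero, mul_zero, add_zero, sub_zero, max_eq_left (by linarith)]
    · simp only [hG]
      rw [sub_self, zero_div, sub_zero, max_eq_right (by nlinarith)]
  refine frechetDist_le_of_forall hGr fun t ht => ?_
  have hGt := hGr.mapsTo ht
  have hφt := hφm t ht
  have hAG : A (G t) = A (min (G t) (φ 1)) := by
    rcases le_total (G t) (φ 1) with hle | hle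
    · rw [min_eq_left hle]
    · rw [min_eq_right hle, hconst _ ⟨hle, hGt.2⟩]
  have hlow : φ t - δ ≤ (1 - δ) * φ t + δ * t := by
    nlinarith [mul_nonneg hδ.le ht.1, mul_nonneg hδ.le (sub_nonneg.mpr (hφt.2.trans hφ1))]
  have hdist : dist (min (G t) (φ 1)) (φ t) < η := by
    rw [Real.dist_eq, abs_lt]
    constructor
    · have : φ t - δ ≤ min (G t) (φ 1) :=
        le_min (hlow.trans (le_max_left _ _)) (by linarith [hφt.2])
      linarith
    · rcases le_total (1 - (1 - t) / δ) ((1 - δ) * φ t + δ * t) with hle | hle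
      · have h1 : G t = (1 - δ) * φ t + δ * t := max_eq_left hle
        have h2 := min_le_left (G t) (φ 1)
        nlinarith [mul_nonneg hδ.le hφt.1, mul_nonneg hδ.le (sub_nonneg.mpr ht.2)]
      · have h1 : (1 - t) / δ ≤ 1 := by
          have h2 : 0 ≤ (1 - δ) * φ t + δ * t :=
            add_nonneg (mul_nonneg (by linarith) hφt.1) (mul_nonneg hδ.le ht.1)
          linarith
        rw [div_le_one hδ] at h1
        have h2 := hφδ ht (by rw [Real.dist_eq, abs_lt]; constructor <;> linarith [ht.2])
        rw [Real.dist_eq, abs_lt] at h2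
        linarith [min_le_right (G t) (φ 1), h2.1]
  have hclose := hAη (min (G t) (φ 1))
    ⟨le_min hGt.1 (hφt.1.trans hφt.2), (min_le_left _ _).trans hGt.2⟩
    (φ t) ⟨hφt.1, hφt.2.trans hφ1⟩ hdist
  rw [dist_eq_norm, ← hAG] at hclose
  calc ‖A (G t) - B t‖ ≤ ‖A (G t) - A (φ t)‖ + ‖A (φ t) - B t‖ :=
        norm_sub_le_norm_sub_add_norm_sub ..
    _ ≤ r + ε := by linarith [h t ht]

section SimplIdx

variable (v : ℕ → EuclideanSpace ℝ (Fin d)) (μ : ℝ) (n : ℕ)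

theorem simplIdx_le (k : ℕ) : simplIdx v μ n k ≤ n := by
  classical
  cases k with
  | zero => exact n.zero_le
  | succ k =>
    rw [simplIdx]
    split_ifs with h
    · convert (Nat.find_spec h).2.1
    · exact le_rfl

variable {n}

theorem simplIdx_lt_succ {k : ℕ} (hk : simplIdx v μ n k < n) :
    simplIdx v μ n k < simplIdx v μ n (k + 1) := by
  classical
  rw [simplIdx]
  split_ifs with h
  · convert (Nat.find_spec h).1
  · exact hk

variable {v μ}

theorem simplIdx_eq_of_le {k l : ℕ} (hk : simplIdx v μ n k = n) (hkl : k ≤ l) :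
    simplIdx v μ n l = n := by
  induction l, hkl using Nat.le_induction with
  | base => exact hk
  | succ l _ ih =>
    rw [simplIdx, dif_neg]
    rintro ⟨j, h1, h2, -⟩
    omega

theorem norm_sub_simplIdx_le (hμ : 0 ≤ μ) {k j : ℕ} (h1 : simplIdx v μ n k ≤ j)
    (h2 : j < simplIdx v μ n (k + 1)) : ‖v (simplIdx v μ n k) - v j‖ ≤ μ := by
  classical
  rcases h1.eq_or_lt with h1 | h1
  · simpa [h1] using hμ
  rw [norm_sub_rev]
  by_contra! hlt
  have hjn : j ≤ n := h2.le.trans (simplIdx_le v μ n _)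
  have hex : ∃ j, simplIdx v μ n k < j ∧ j ≤ n ∧ μ ≤ ‖v j - v (simplIdx v μ n k)‖ :=
    ⟨j, h1, hjn, hlt.le⟩
  rw [simplIdx, dif_pos hex] at h2
  exact Nat.find_min hex (by convert h2) ⟨h1, hjn, hlt.le⟩

end SimplIdx

/-- For a strictly increasing sequence `I` with `I 0 = 0`, the number of positive indices `k` with
`I k ≤ j`. -/
def lastIdx (I : ℕ → ℕ) : ℕ → ℕ
  | 0 => 0
  | j + 1 => if I (lastIdx I j + 1) = j + 1 then lastIdx I j + 1 else lastIdx I j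

theorem lastIdx_succ (I : ℕ → ℕ) (j : ℕ) :
    lastIdx I (j + 1) = lastIdx I j ∨ lastIdx I (j + 1) = lastIdx I j + 1 := by
  rw [lastIdx]
  split_ifs <;> simp

theorem monotone_lastIdx (I : ℕ → ℕ) : Monotone (lastIdx I) :=
  monotone_nat_of_le_succ fun j => by rcases lastIdx_succ I j with h | h <;> omega

theorem lastIdx_le_self (I : ℕ → ℕ) (j : ℕ) : lastIdx I j ≤ j := by
  induction j with
  | zero => exact le_rfl
  | succ j ih => rcases lastIdx_succ I j with h | h <;> omega

theorem lastIdx_le {I : ℕ → ℕ} {n : ℕ} (hI : ∀ k, I k ≤ n) (j : ℕ) : lastIdx I j ≤ n := by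
  induction j with
  | zero => exact n.zero_le
  | succ j ih =>
    rw [lastIdx]
    split_ifs with h
    · have := hI (lastIdx I j + 1)
      have := lastIdx_le_self I j
      omega
    · exact ih

theorem lastIdx_spec {I : ℕ → ℕ} {n : ℕ} (hI0 : I 0 = 0) (hI : ∀ k, I k ≤ n)
    (hlt : ∀ k, I k < n → I k < I (k + 1)) (j : ℕ) :
    I (lastIdx I j) ≤ j ∧ (j < n → j < I (lastIdx I j + 1)) ∧ (n ≤ j → I (lastIdx I j) = n) := by
  induction j with
  | zero =>
    have := hlt 0
    simp only [lastIdx]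
    omega
  | succ j ih =>
    have h1 := hI (lastIdx I j + 1)
    rw [lastIdx]
    split_ifs with h
    · have := hlt (lastIdx I j + 1)
      omega
    · omega

/-- For any polygonal curve `X` and any `μ > 0`, the Fréchet distance
between `X` and its `μ`-simplification is at most `μ`. -/
theorem frechetDist_simpl_le {d n : ℕ} (v : Fin (n+1) → EuclideanSpace ℝ (Fin d))
    (μ : ℝ) (hμ : 0 < μ) :
    frechetDist (simpl v μ) (polyCurve v) ≤ μ := by
  set I := simplIdx (vtx v) μ n with hIdef
  set c := lastIdx I with hc
  have hI : ∀ k, I k ≤ n := simplIdx_le _ _ _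
  have hspec := lastIdx_spec (I := I) rfl hI fun k => simplIdx_lt_succ _ _
  have hcn : ∀ j, c j ≤ n := lastIdx_le hI
  have hvtx : ∀ k ≤ n, vtx (simplVerts v μ) k = vtx v (I k) := by
    intro k hk
    simp only [vtx, simplVerts, min_eq_left hk, hIdef]
  have hdist : ∀ j, ‖(vtx (simplVerts v μ) ∘ c) j - vtx v j‖ ≤ μ := by
    intro j
    rw [Function.comp_apply, hvtx _ (hcn j)]
    rcases lt_or_ge j n with hj | hj
    · exact norm_sub_simplIdx_le hμ.le (hspec j).1 ((hspec j).2.1 hj)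
    · rw [(hspec j).2.2 hj]
      simpa [vtx, hj] using hμ.le
  set F := piecewiseLinear (n + 1) (fun j => (c j : ℝ)) with hF
  have hFn : F n = c n := piecewiseLinear_natCast _ _ n.lt_succ_self
  have hF0 : F 0 = 0 := by
    simpa [hc, lastIdx] using
      piecewiseLinear_natCast (n + 1) (fun j => (c j : ℝ)) n.succ_pos
  have hFmono : Monotone F :=
    monotone_piecewiseLinear _ fun i j hij => Nat.cast_le.mpr (monotone_lastIdx I hij)
  have hφn : ∀ t : ℝ, F (t * n) / n * n = F (t * n) := by
    intro t
    rcases n.eq_zero_or_pos with rfl | hn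
    · simp [hF0]
    · exact div_mul_cancel₀ _ (by positivity)
  have hφmono : Monotone fun t : ℝ => F (t * n) / n := fun s t hst => by
    have := hFmono (mul_le_mul_of_nonneg_right hst (Nat.cast_nonneg (α := ℝ) n))
    simp only
    gcongr
  have hφ0 : F ((0 : ℝ) * n) / n = 0 := by simp [hF0]
  have hφ1 : F ((1 : ℝ) * n) / n ≤ 1 := by
    rw [one_mul, hFn]
    exact div_le_one_of_le₀ (by exact_mod_cast hcn n) n.cast_nonneg
  have hend : ∀ x ∈ Icc (F ((1 : ℝ) * n) / n) 1, simpl v μ x = vtx v n := by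
    intro x hx
    have hxn : (c n : ℝ) ≤ x * n := by
      have := mul_le_mul_of_nonneg_right hx.1 (Nat.cast_nonneg (α := ℝ) n)
      rwa [hφn, one_mul, hFn] at this
    have hfl : c n ≤ ⌊x * n⌋₊ := Nat.le_floor hxn
    have hw : ∀ k, c n ≤ k → vtx (simplVerts v μ) k = vtx v n := by
      intro k hk
      have h1 : vtx (simplVerts v μ) k = vtx (simplVerts v μ) (min k n) := by simp [vtx]
      rw [h1, hvtx _ (min_le_right _ _), hIdef,
        simplIdx_eq_of_le ((hspec n).2.2 le_rfl) (le_min hk (hcn n))]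
    rw [simpl, polyCurve, hw _ hfl, hw _ (hfl.trans (Nat.le_succ _)), ← add_smul, sub_add_cancel,
      one_smul]
  refine frechetDist_le_of_monotoneOn (φ := fun t => F (t * n) / n) ?_ ?_ (hφmono.monotoneOn _)
    hφ0 hφ1 ?_ ?_
  · refine ContinuousOn.congr (Continuous.continuousOn ?_) fun t ht =>
      polyCurve_eq_piecewiseLinear (simplVerts v μ) ht
    exact (continuous_piecewiseLinear _ _).comp (by fun_prop)
  · have := continuous_piecewiseLinear (n + 1) (fun j => (c j : ℝ))
    exact Continuous.continuousOn (by fun_prop)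
  · intro x hx
    rw [hend x hx, hend _ ⟨le_rfl, hφ1⟩]
  · intro t ht
    have htn : t * n ∈ Icc (0 : ℝ) n :=
      ⟨mul_nonneg ht.1 n.cast_nonneg, mul_le_of_le_one_left n.cast_nonneg ht.2⟩
    have hφt : F (t * n) / n ∈ Icc (0 : ℝ) 1 :=
      ⟨hφ0 ▸ hφmono ht.1, (hφmono ht.2).trans hφ1⟩
    rw [simpl, polyCurve_eq_piecewiseLinear _ hφt, polyCurve_eq_piecewiseLinear _ ht, hφn, hF,
      piecewiseLinear_piecewiseLinear _ (lastIdx_succ I) hcn htn]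
    exact norm_piecewiseLinear_sub_le hdist htn

end Jaywalk
end
end
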